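/- Let n ≥ 2, let δ > 0, and let (R^(i))_{i≥1} be a sequence of proper rigid n-systems of mesh δ. Suppose there exists a convergent sequence (x^(i))_{i≥1} in ℝ^n with x^(i) ∈ F(R^(i), e_1) for every i. Then there exists a proper rigid n-system R of mesh δ such that F(R) = limsup_{i→∞} F(R^(i)). -/

import Mathlib

open Filter Set Pointwise Topology

noncomputable section

/-- Points of `ℝ^n`. -/
abbrev RVec (n : ℕ) := Fin n → ℝ

/-- The vector of `ℝ^n` with a `1` in position `j` (0-based) and `0` elsewhere;
`eVec n 0` is the first canonical basis vector `e_1`. -/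
def eVec (n : ℕ) (j : ℕ) : RVec n := fun i => if (i : ℕ) = j then 1 else 0

/-- `P` is an `n`-system on the subinterval `I` of `[0,∞)`:
`I` is an order-connected subset of `[0,∞)` with nonempty interior, and conditions
(S1), (S2), (S3) hold at every `q ∈ I`. -/
def IsNSystem (n : ℕ) (I : Set ℝ) (P : ℝ → RVec n) : Prop :=
  I ⊆ Set.Ici (0 : ℝ) ∧ I.OrdConnected ∧ (interior I).Nonempty ∧
  ∀ q ∈ I,
    ((∀ i, 0 ≤ P q i) ∧ Monotone (P q) ∧ (∑ i, P q i) = q) ∧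
    ∃ ε > (0 : ℝ), ∃ k ℓ : Fin n,
      (∀ t ∈ I ∩ Set.Icc (q - ε) q, P t = P q + (t - q) • eVec n ℓ) ∧
      (∀ t ∈ I ∩ Set.Icc q (q + ε), P t = P q + (t - q) • eVec n k) ∧
      (q ∈ interior I → ℓ < k → ∀ i : Fin n, ℓ ≤ i → i ≤ k → P q i = P q ℓ)

/-- `P` is a proper `n`-system on `I`: it is an `n`-system whose first component is
unbounded (by the monotonicity (S1) of the components, this is equivalent to all
components simultaneously exceeding any given bound). -/
def IsProperSys (n : ℕ) (I : Set ℝ) (P : ℝ → RVec n) : Prop :=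
  IsNSystem n I P ∧ ∀ M : ℝ, ∃ q ∈ I, ∀ i, M < P q i

/-- The set `F(P)` of limits of `q_i⁻¹ • P(q_i)` along strictly increasing unbounded
sequences `(q_i)` in `I`. -/
def FSet (n : ℕ) (I : Set ℝ) (P : ℝ → RVec n) : Set (RVec n) :=
  {x | ∃ q : ℕ → ℝ, (∀ i, q i ∈ I) ∧ StrictMono q ∧
    Tendsto q atTop atTop ∧ Tendsto (fun i => (q i)⁻¹ • P (q i)) atTop (𝓝 x)}

/-- The set `F(P, e₁)`: as `F(P)`, but with the extra requirement that the right
derivative of `P` at each `q_i` is the first basis vector `e_1`. -/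
def FSetE1 (n : ℕ) (I : Set ℝ) (P : ℝ → RVec n) : Set (RVec n) :=
  {x | ∃ q : ℕ → ℝ, (∀ i, q i ∈ I) ∧ StrictMono q ∧ Tendsto q atTop atTop ∧
    (∀ i, ∃ ε > (0 : ℝ), ∀ t ∈ I ∩ Set.Icc (q i) (q i + ε),
      P t = P (q i) + (t - q i) • eVec n 0) ∧
    Tendsto (fun i => (q i)⁻¹ • P (q i)) atTop (𝓝 x)}

/-- `q` is a switch number of the `n`-system `P` on `I`: a point of `I` on the boundary
of `I`, or an interior point where the local slopes `e_k` (right) and `e_ℓ` (left)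
from (S2) satisfy `k < ℓ`. -/
def IsSwitchNumber (n : ℕ) (I : Set ℝ) (P : ℝ → RVec n) (q : ℝ) : Prop :=
  q ∈ I ∧ (q ∈ frontier I ∨
    (q ∈ interior I ∧ ∃ ε > (0 : ℝ), ∃ k ℓ : Fin n, k < ℓ ∧
      (∀ t ∈ I ∩ Set.Icc (q - ε) q, P t = P q + (t - q) • eVec n ℓ) ∧
      (∀ t ∈ I ∩ Set.Icc q (q + ε), P t = P q + (t - q) • eVec n k)))

/-- `q` is a division number of the `n`-system `P` on `I`: a point of `I` on the boundary
of `I`, or an interior point where `P` is not differentiable, i.e. where the left and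
right slopes from (S2) differ. -/
def IsDivisionNumber (n : ℕ) (I : Set ℝ) (P : ℝ → RVec n) (q : ℝ) : Prop :=
  q ∈ I ∧ (q ∈ frontier I ∨
    (q ∈ interior I ∧ ∃ ε > (0 : ℝ), ∃ k ℓ : Fin n, k ≠ ℓ ∧
      (∀ t ∈ I ∩ Set.Icc (q - ε) q, P t = P q + (t - q) • eVec n ℓ) ∧
      (∀ t ∈ I ∩ Set.Icc q (q + ε), P t = P q + (t - q) • eVec n k)))

/-- A non-degenerate `n`-system: an `n`-system whose domain is a closed subinterval
of `(0,∞)` and whose switch points all have `n` distinct positive coordinates. -/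
def IsNonDegenerate (n : ℕ) (I : Set ℝ) (P : ℝ → RVec n) : Prop :=
  IsNSystem n I P ∧ IsClosed I ∧ I ⊆ Set.Ioi (0 : ℝ) ∧
  ∀ q, IsSwitchNumber n I P q → (∀ i, 0 < P q i) ∧ StrictMono (P q)

/-- A rigid `n`-system of mesh `δ`: a non-degenerate `n`-system whose switch points
belong to `δℤ^n`. -/
def IsRigid (n : ℕ) (δ : ℝ) (I : Set ℝ) (P : ℝ → RVec n) : Prop :=
  IsNonDegenerate n I P ∧
  ∀ q, IsSwitchNumber n I P q → ∀ i, ∃ m : ℤ, P q i = δ * m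

/-- A self-similar system: the domain is unbounded and there is `ρ > 1` with
`P(ρq) = ρ • P(q)` for all `q` in the domain. -/
def IsSelfSimilar (n : ℕ) (I : Set ℝ) (P : ℝ → RVec n) : Prop :=
  ¬ BddAbove I ∧ ∃ ρ : ℝ, 1 < ρ ∧ ∀ q ∈ I, ρ * q ∈ I ∧ P (ρ * q) = ρ • P q

/-- The cube `[-ε, ε]^n`. -/
def cubeNbhd (n : ℕ) (ε : ℝ) : Set (RVec n) := {y | ∀ i, |y i| ≤ ε}

/-- The distance `dist(E, F)`: the infimum of all `ε > 0` such that
`E ⊆ F + [-ε,ε]^n` and `F ⊆ E + [-ε,ε]^n`. -/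
def cubeDist (n : ℕ) (E F : Set (RVec n)) : ℝ :=
  sInf {ε : ℝ | 0 < ε ∧ E ⊆ F + cubeNbhd n ε ∧ F ⊆ E + cubeNbhd n ε}

/-- `μ_T(P)`: the point of `ℝ^m` whose `j`-th coordinate is
`liminf_{q → ∞, q ∈ I} T_j(P(q))/q`. -/
def muT (n m : ℕ) (T : RVec n → RVec m) (I : Set ℝ) (P : ℝ → RVec n) : RVec m :=
  fun j => Filter.liminf (fun q => T (P q) j / q) (atTop ⊓ 𝓟 I)

/-- `liminf` of a sequence of subsets of `ℝ^n`: the set of limits of convergent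
sequences `(x_i)` with `x_i ∈ F i` for every `i`. -/
def setLiminf (n : ℕ) (F : ℕ → Set (RVec n)) : Set (RVec n) :=
  {x | ∃ y : ℕ → RVec n, (∀ i, y i ∈ F i) ∧ Tendsto y atTop (𝓝 x)}

/-- `limsup` of a sequence of subsets of `ℝ^n`: the set of accumulation points of
sequences `(x_i)` with `x_i ∈ F i` for every `i`, i.e. limits of convergent
subsequences. -/
def setLimsup (n : ℕ) (F : ℕ → Set (RVec n)) : Set (RVec n) :=
  {x | ∃ (y : ℕ → RVec n) (φ : ℕ → ℕ), (∀ i, y i ∈ F i) ∧ StrictMono φ ∧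
    Tendsto (y ∘ φ) atTop (𝓝 x)}

section HalfLine

variable {n : ℕ} {δ : ℝ}

/-- `P` is affine with direction `e_{k+1}` on the right of `q`. -/
def HasRightSlope (P : ℝ → RVec n) (q : ℝ) (k : ℕ) : Prop :=
  ∀ᶠ t in 𝓝[≥] q, P t = P q + (t - q) • eVec n k

/-- `P` is affine with direction `e_{k+1}` on the left of `q`. -/
def HasLeftSlope (P : ℝ → RVec n) (q : ℝ) (k : ℕ) : Prop :=
  ∀ᶠ t in 𝓝[≤] q, P t = P q + (t - q) • eVec n k

/-- A point with distinct positive coordinates, listed in increasing order, in `δℤ^n`. -/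
def IsRigidPoint (δ : ℝ) (y : RVec n) : Prop :=
  (∀ i, 0 < y i) ∧ StrictMono y ∧ ∀ i, ∃ m : ℤ, y i = δ * m

/-- A proper rigid `n`-system of mesh `δ` on the half-line `[a, ∞)`, in terms of one-sided
slopes. -/
structure IsHalfLineRigid (n : ℕ) (δ a : ℝ) (P : ℝ → RVec n) : Prop where
  pos : 0 < a
  nonneg : ∀ q, a ≤ q → ∀ i, 0 ≤ P q i
  mono : ∀ q, a ≤ q → Monotone (P q)
  sum : ∀ q, a ≤ q → ∑ i, P q i = q
  right : ∀ q, a ≤ q → ∃ k : Fin n, HasRightSlope P q k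
  left : ∀ q, a < q → ∃ k : Fin n, HasLeftSlope P q k
  eq_of_lt : ∀ q, a < q → ∀ k l : Fin n, HasRightSlope P q k → HasLeftSlope P q l → l < k →
    P q k = P q l
  rigidPoint_of_lt : ∀ q, a < q → ∀ k l : Fin n, HasRightSlope P q k → HasLeftSlope P q l →
    k < l → IsRigidPoint δ (P q)
  rigidPoint_start : IsRigidPoint δ (P a)
  unbounded : ∀ M : ℝ, ∃ q, a ≤ q ∧ ∀ i, M < P q i

theorem eVec_self (k : Fin n) : eVec n k k = 1 := by simp [eVec]

theorem eVec_of_ne {i : Fin n} {k : ℕ} (h : (i : ℕ) ≠ k) : eVec n k i = 0 := by simp [eVec, h]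

theorem eVec_nonneg (k : ℕ) (i : Fin n) : 0 ≤ eVec n k i := by
  unfold eVec; split_ifs <;> norm_num

theorem HasRightSlope.unique {P : ℝ → RVec n} {q : ℝ} {k : Fin n} {l : ℕ}
    (hk : HasRightSlope P q k) (hl : HasRightSlope P q l) : (k : ℕ) = l := by
  have h : ∀ᶠ t in 𝓝[>] q, P t = P q + (t - q) • eVec n k ∧ P t = P q + (t - q) • eVec n l :=
    nhdsWithin_mono q Ioi_subset_Ici_self (hk.and hl)
  obtain ⟨t, ⟨h1, h2⟩, ht⟩ := (h.and self_mem_nhdsWithin).exists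
  by_contra hne
  have := congrFun (h1.symm.trans h2) k
  simp only [Pi.add_apply, Pi.smul_apply, smul_eq_mul, eVec_self, eVec_of_ne hne] at this
  have ht : q < t := ht
  linarith

theorem HasLeftSlope.unique {P : ℝ → RVec n} {q : ℝ} {k : Fin n} {l : ℕ}
    (hk : HasLeftSlope P q k) (hl : HasLeftSlope P q l) : (k : ℕ) = l := by
  have h : ∀ᶠ t in 𝓝[<] q, P t = P q + (t - q) • eVec n k ∧ P t = P q + (t - q) • eVec n l :=
    nhdsWithin_mono q Iio_subset_Iic_self (hk.and hl)
  obtain ⟨t, ⟨h1, h2⟩, ht⟩ := (h.and self_mem_nhdsWithin).exists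
  by_contra hne
  have := congrFun (h1.symm.trans h2) k
  simp only [Pi.add_apply, Pi.smul_apply, smul_eq_mul, eVec_self, eVec_of_ne hne] at this
  have ht : t < q := ht
  linarith

theorem hasRightSlope_iff {P : ℝ → RVec n} {a q : ℝ} {k : ℕ} (hq : a ≤ q) :
    HasRightSlope P q k ↔
      ∃ ε > (0 : ℝ), ∀ t ∈ Ici a ∩ Icc q (q + ε), P t = P q + (t - q) • eVec n k := by
  constructor
  · intro h
    obtain ⟨u, hu, h⟩ := mem_nhdsGE_iff_exists_Icc_subset.1 h
    refine ⟨u - q, sub_pos.2 hu, fun t ht => h ⟨ht.2.1, ?_⟩⟩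
    simpa using ht.2.2
  · rintro ⟨ε, hε, h⟩
    refine mem_nhdsGE_iff_exists_Icc_subset.2 ⟨q + ε, ?_, fun t ht => h t ⟨hq.trans ht.1, ht⟩⟩
    simpa using hε

theorem hasLeftSlope_iff {P : ℝ → RVec n} {a q : ℝ} {k : ℕ} (hq : a < q) :
    HasLeftSlope P q k ↔
      ∃ ε > (0 : ℝ), ∀ t ∈ Ici a ∩ Icc (q - ε) q, P t = P q + (t - q) • eVec n k := by
  have hmem : Ici a ∈ 𝓝[≤] q := mem_nhdsWithin_of_mem_nhds (Ici_mem_nhds hq)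
  constructor
  · intro h
    obtain ⟨u, hu, h⟩ := mem_nhdsLE_iff_exists_Icc_subset.1 h
    refine ⟨q - u, sub_pos.2 hu, fun t ht => h ⟨?_, ht.2.2⟩⟩
    simpa using ht.2.1
  · rintro ⟨ε, hε, h⟩
    have : Icc (q - ε) q ∈ 𝓝[≤] q :=
      mem_nhdsLE_iff_exists_Icc_subset.2 ⟨q - ε, by simpa using hε, Subset.rfl⟩
    filter_upwards [hmem, this] with t h1 h2 using h t ⟨h1, h2⟩

theorem exists_eq_Ici_of_isProperSys (hn : 0 < n) {I : Set ℝ} {P : ℝ → RVec n}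
    (hc : IsClosed I) (hpos : I ⊆ Ioi 0) (hP : IsProperSys n I P) : ∃ a > 0, I = Ici a := by
  obtain ⟨⟨-, hoc, hint, hsys⟩, hub⟩ := hP
  have hne : I.Nonempty := hint.mono interior_subset
  have hbdd : BddBelow I := ⟨0, fun x hx => (hpos hx).le⟩
  have hmem : sInf I ∈ I := hc.csInf_mem hne hbdd
  refine ⟨sInf I, hpos hmem, Subset.antisymm (fun x hx => csInf_le hbdd hx) fun x hx => ?_⟩
  obtain ⟨q, hq, hxq⟩ := hub |x|
  refine hoc.out hmem hq ⟨hx, ?_⟩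
  obtain ⟨⟨h0, -, hsum⟩, -⟩ := hsys q hq
  calc x ≤ |x| := le_abs_self x
    _ ≤ P q ⟨0, hn⟩ := (hxq _).le
    _ ≤ ∑ i, P q i := Finset.single_le_sum (fun i _ => h0 i) (Finset.mem_univ _)
    _ = q := hsum

theorem IsRigid.exists_isHalfLineRigid (hn : 0 < n) {I : Set ℝ} {P : ℝ → RVec n}
    (hP : IsRigid n δ I P) (hP' : IsProperSys n I P) :
    ∃ a, I = Ici a ∧ IsHalfLineRigid n δ a P := by
  obtain ⟨⟨hsys, hc, hpos, hdist⟩, hlat⟩ := hP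
  obtain ⟨a, ha, rfl⟩ := exists_eq_Ici_of_isProperSys hn hc hpos hP'
  have hrp : ∀ q, IsSwitchNumber n (Ici a) P q → IsRigidPoint δ (P q) := fun q hq =>
    ⟨(hdist q hq).1, (hdist q hq).2, hlat q hq⟩
  refine ⟨a, rfl, ⟨ha, fun q hq => (hsys.2.2.2 q hq).1.1, fun q hq => (hsys.2.2.2 q hq).1.2.1,
    fun q hq => (hsys.2.2.2 q hq).1.2.2, fun q hq => ?_, fun q hq => ?_,
    fun q hq k l hk hl hlk => ?_, fun q hq k l hk hl hkl => ?_, ?_, hP'.2⟩⟩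
  · obtain ⟨-, ε, hε, k, -, -, h, -⟩ := hsys.2.2.2 q hq
    exact ⟨k, (hasRightSlope_iff hq).2 ⟨ε, hε, h⟩⟩
  · obtain ⟨-, ε, hε, -, l, h, -, -⟩ := hsys.2.2.2 q hq.le
    exact ⟨l, (hasLeftSlope_iff hq).2 ⟨ε, hε, h⟩⟩
  · obtain ⟨-, ε, hε, k', l', h1, h2, h3⟩ := hsys.2.2.2 q hq.le
    obtain rfl : k = k' := Fin.ext (hk.unique ((hasRightSlope_iff hq.le).2 ⟨ε, hε, h2⟩))
    obtain rfl : l = l' := Fin.ext (hl.unique ((hasLeftSlope_iff hq).2 ⟨ε, hε, h1⟩))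
    exact h3 (by simpa using hq) hlk k hlk.le le_rfl
  · obtain ⟨ε₁, hε₁, h1⟩ := (hasRightSlope_iff hq.le).1 hk
    obtain ⟨ε₂, hε₂, h2⟩ := (hasLeftSlope_iff hq).1 hl
    refine hrp q ⟨hq.le, Or.inr ⟨by simpa using hq, min ε₁ ε₂, lt_min hε₁ hε₂, k, l, hkl,
      fun t ht => h2 t ⟨ht.1, ?_, ht.2.2⟩, fun t ht => h1 t ⟨ht.1, ht.2.1, ?_⟩⟩⟩
    · linarith [ht.2.1, min_le_right ε₁ ε₂]
    · linarith [ht.2.2, min_le_left ε₁ ε₂]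
  · exact hrp a ⟨self_mem_Ici, Or.inl (by simp)⟩

namespace IsHalfLineRigid

variable {a : ℝ} {P : ℝ → RVec n}

theorem isNSystem (hn : 0 < n) (hP : IsHalfLineRigid n δ a P) : IsNSystem n (Ici a) P := by
  refine ⟨Ici_subset_Ici.2 hP.pos.le, ordConnected_Ici, by simp, fun q hq =>
    ⟨⟨hP.nonneg q hq, hP.mono q hq, hP.sum q hq⟩, ?_⟩⟩
  obtain ⟨k, hk⟩ := hP.right q hq
  obtain ⟨ε₁, hε₁, h1⟩ := (hasRightSlope_iff hq).1 hk
  rcases eq_or_lt_of_le (mem_Ici.1 hq) with rfl | hlt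
  · refine ⟨ε₁, hε₁, k, ⟨0, hn⟩, fun t ht => ?_, h1, fun h => ?_⟩
    · obtain rfl : t = a := le_antisymm ht.2.2 ht.1
      simp
    · simp at h
  · obtain ⟨l, hl⟩ := hP.left q hlt
    obtain ⟨ε₂, hε₂, h2⟩ := (hasLeftSlope_iff hlt).1 hl
    refine ⟨min ε₁ ε₂, lt_min hε₁ hε₂, k, l, fun t ht => h2 t ⟨ht.1, ?_, ht.2.2⟩,
      fun t ht => h1 t ⟨ht.1, ht.2.1, ?_⟩, fun _ hlk i hli hik => ?_⟩
    · linarith [ht.2.1, min_le_right ε₁ ε₂]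
    · linarith [ht.2.2, min_le_left ε₁ ε₂]
    · exact le_antisymm ((hP.mono q hq hik).trans (hP.eq_of_lt q hlt k l hk hl hlk).le)
        (hP.mono q hq hli)

theorem isProperSys (hn : 0 < n) (hP : IsHalfLineRigid n δ a P) : IsProperSys n (Ici a) P :=
  ⟨hP.isNSystem hn, hP.unbounded⟩

theorem isRigid (hn : 0 < n) (hP : IsHalfLineRigid n δ a P) : IsRigid n δ (Ici a) P := by
  have hrp : ∀ q, IsSwitchNumber n (Ici a) P q → IsRigidPoint δ (P q) := by
    rintro q ⟨-, hq | ⟨hq, ε, hε, k, l, hkl, h1, h2⟩⟩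
    · obtain rfl : q = a := by simpa using hq
      exact hP.rigidPoint_start
    · have hq : a < q := by simpa using hq
      exact hP.rigidPoint_of_lt q hq k l ((hasRightSlope_iff hq.le).2 ⟨ε, hε, h2⟩)
        ((hasLeftSlope_iff hq).2 ⟨ε, hε, h1⟩) hkl
  exact ⟨⟨hP.isNSystem hn, isClosed_Ici, fun x hx => hP.pos.trans_le hx,
    fun q hq => ⟨(hrp q hq).1, (hrp q hq).2.1⟩⟩, fun q hq => (hrp q hq).2.2⟩

theorem restrict (hP : IsHalfLineRigid n δ a P) {b : ℝ} (hab : a ≤ b)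
    (hb : IsRigidPoint δ (P b)) (hu : ∀ M : ℝ, ∃ q, b ≤ q ∧ ∀ i, M < P q i) :
    IsHalfLineRigid n δ b P where
  pos := hP.pos.trans_le hab
  nonneg q hq := hP.nonneg q (hab.trans hq)
  mono q hq := hP.mono q (hab.trans hq)
  sum q hq := hP.sum q (hab.trans hq)
  right q hq := hP.right q (hab.trans hq)
  left q hq := hP.left q (hab.trans_lt hq)
  eq_of_lt q hq := hP.eq_of_lt q (hab.trans_lt hq)
  rigidPoint_of_lt q hq := hP.rigidPoint_of_lt q (hab.trans_lt hq)
  rigidPoint_start := hb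
  unbounded := hu

theorem continuousAt (hP : IsHalfLineRigid n δ a P) {q : ℝ} (hq : a < q) :
    ContinuousAt P q := by
  have key : ∀ k : ℕ, Tendsto (fun t => P q + (t - q) • eVec n k) (𝓝 q) (𝓝 (P q)) := fun k => by
    have : Continuous fun t : ℝ => P q + (t - q) • eVec n k := by fun_prop
    simpa using this.tendsto q
  obtain ⟨k, hk⟩ := hP.right q hq.le
  obtain ⟨l, hl⟩ := hP.left q hq
  rw [continuousAt_iff_continuous_left_right]
  exact ⟨((key l).mono_left nhdsWithin_le_nhds).congr' (hl.mono fun _ h => h.symm),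
    ((key k).mono_left nhdsWithin_le_nhds).congr' (hk.mono fun _ h => h.symm)⟩

theorem continuousOn (hP : IsHalfLineRigid n δ a P) : ContinuousOn P (Ici a) := by
  intro q hq
  rcases eq_or_lt_of_le (mem_Ici.1 hq) with rfl | hlt
  · obtain ⟨k, hk⟩ := hP.right a hq
    have : Continuous fun t : ℝ => P a + (t - a) • eVec n k := by fun_prop
    refine Tendsto.congr' (hk.mono fun _ h => h.symm) ?_
    simpa using (this.tendsto a).mono_left nhdsWithin_le_nhds
  · exact (hP.continuousAt hlt).continuousWithinAt

theorem monotoneOn (hP : IsHalfLineRigid n δ a P) : MonotoneOn P (Ici a) := by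
  intro s hs u hu hsu
  have hs : a ≤ s := hs
  have hcont : ContinuousOn P (Icc s u) := hP.continuousOn.mono fun t ht => hs.trans ht.1
  have hclosed : IsClosed ({t | P s ≤ P t} ∩ Icc s u) := by
    have := hcont.preimage_isClosed_of_isClosed isClosed_Icc (isClosed_Ici (a := P s))
    rwa [inter_comm] at this
  refine hclosed.Icc_subset_of_forall_mem_nhdsWithin (le_refl (P s)) (fun t ht => ?_) ⟨hsu, le_rfl⟩
  obtain ⟨k, hk⟩ := hP.right t (hs.trans ht.2.1)
  filter_upwards [nhdsWithin_mono t Ioi_subset_Ici_self hk, self_mem_nhdsWithin] with v hv htv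
  have htv : t < v := htv
  change P s ≤ P v
  rw [hv]
  refine ht.1.trans (le_add_of_nonneg_right (smul_nonneg (sub_nonneg.2 htv.le) ?_))
  exact fun i => eVec_nonneg k i

theorem apply_le_apply (hP : IsHalfLineRigid n δ a P) {s u : ℝ} (hs : a ≤ s) (hsu : s ≤ u)
    (i : Fin n) : P s i ≤ P u i :=
  hP.monotoneOn hs (hs.trans hsu) hsu i

theorem apply_le (hP : IsHalfLineRigid n δ a P) {s : ℝ} (hs : a ≤ s) (i : Fin n) : P s i ≤ s :=
  (Finset.single_le_sum (f := P s) (fun i _ => hP.nonneg s hs i) (Finset.mem_univ i)).trans_eq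
    (hP.sum s hs)

theorem eventually_lt_apply (hP : IsHalfLineRigid n δ a P) (M : ℝ) :
    ∀ᶠ q in atTop, ∀ i, M < P q i := by
  obtain ⟨q, hq, h⟩ := hP.unbounded M
  filter_upwards [eventually_ge_atTop q] with u hu i using
    (h i).trans_le (hP.apply_le_apply hq hu i)

theorem restrict_of_le (hP : IsHalfLineRigid n δ a P) {b : ℝ} (hab : a ≤ b)
    (hb : IsRigidPoint δ (P b)) : IsHalfLineRigid n δ b P := by
  refine hP.restrict hab hb fun M => ?_
  obtain ⟨q, h1, h2⟩ := ((hP.eventually_lt_apply M).and (eventually_ge_atTop b)).exists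
  exact ⟨q, h2, h1⟩

/-- Tracing back a segment with direction `e_1` leads to a rigid point. -/
theorem exists_rigidPoint_of_hasRightSlope_zero (hP : IsHalfLineRigid n δ a P) (hn : 0 < n)
    {q : ℝ} (hq : a ≤ q) (h0 : HasRightSlope P q 0) :
    ∃ s, a ≤ s ∧ s ≤ q ∧ IsRigidPoint δ (P s) ∧
      ∀ t ∈ Icc s q, P t = P s + (t - s) • eVec n 0 := by
  set A : Set ℝ := {s | s ∈ Icc a q ∧ ∀ t ∈ Icc s q, P t = P q + (t - q) • eVec n 0} with hA
  have hqA : q ∈ A := ⟨⟨hq, le_rfl⟩, fun t ht => by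
    obtain rfl : t = q := le_antisymm ht.2 ht.1
    simp⟩
  have hbdd : BddBelow A := ⟨a, fun s hs => hs.1.1⟩
  set s := sInf A with hs
  have has : a ≤ s := le_csInf ⟨q, hqA⟩ fun s hs => hs.1.1
  have hsq : s ≤ q := csInf_le hbdd hqA
  have hline : ∀ t ∈ Ioc s q, P t = P q + (t - q) • eVec n 0 := by
    intro t ht
    obtain ⟨u, hu, hut⟩ := exists_lt_of_csInf_lt ⟨q, hqA⟩ ht.1
    exact hu.2 t ⟨hut.le, ht.2⟩
  have hlines : P s = P q + (s - q) • eVec n 0 := by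
    rcases eq_or_lt_of_le hsq with h | h
    · rw [h]; simp
    have h1 : Tendsto P (𝓝[>] s) (𝓝 (P s)) :=
      (hP.continuousOn s has).mono_left (nhdsWithin_mono s fun t ht => has.trans (le_of_lt ht))
    have h2 : Tendsto P (𝓝[>] s) (𝓝 (P q + (s - q) • eVec n 0)) := by
      have : Continuous fun t : ℝ => P q + (t - q) • eVec n 0 := by fun_prop
      refine Tendsto.congr' ?_ ((this.tendsto s).mono_left nhdsWithin_le_nhds)
      filter_upwards [Ioc_mem_nhdsGT h] with t ht using (hline t ht).symm
    exact tendsto_nhds_unique h1 h2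
  have hlineI : ∀ t ∈ Icc s q, P t = P q + (t - q) • eVec n 0 := by
    intro t ht
    rcases eq_or_lt_of_le ht.1 with h | h
    · rw [← h, hlines]
    · exact hline t ⟨h, ht.2⟩
  refine ⟨s, has, hsq, ?_, fun t ht => ?_⟩
  · rcases eq_or_lt_of_le has with h | h
    · rw [← h]; exact hP.rigidPoint_start
    have hr : HasRightSlope P s 0 := by
      rcases eq_or_lt_of_le hsq with h' | h'
      · rwa [h']
      · filter_upwards [Icc_mem_nhdsGE h'] with t ht
        rw [hlineI t ht, hlines, add_assoc, ← add_smul]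
        ring_nf
    obtain ⟨l, hl⟩ := hP.left s h
    refine hP.rigidPoint_of_lt s h ⟨0, hn⟩ l hr hl ?_
    by_contra hl0
    have hl0 : (l : ℕ) = 0 := Nat.le_zero.1 (not_lt.1 hl0)
    rw [hl0] at hl
    obtain ⟨ε, hε, hl⟩ := (hasLeftSlope_iff h).1 hl
    have hmem : max a (s - ε) ∈ A := by
      refine ⟨⟨le_max_left _ _, (max_le has (by linarith)).trans hsq⟩, fun t ht => ?_⟩
      rcases le_total s t with hst | hts
      · exact hlineI t ⟨hst, ht.2⟩
      · rw [hl t ⟨(le_max_left _ _).trans ht.1, (le_max_right _ _).trans ht.1, hts⟩, hlines,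
          add_assoc, ← add_smul]
        ring_nf
    exact absurd (csInf_le hbdd hmem) (not_le.2 (max_lt h (by linarith)))
  · rw [hlineI t ht, hlines, add_assoc, ← add_smul]
    ring_nf

theorem exists_rigidPoint_near (hP : IsHalfLineRigid n δ a P) (hn : 0 < n) (hδ : 0 < δ)
    {q : ℝ} (hq : a ≤ q) (h0 : HasRightSlope P q 0) :
    ∃ s, a ≤ s ∧ s ≤ q ∧ q - s ≤ δ ∧ IsRigidPoint δ (P s) ∧ HasRightSlope P s 0 := by
  obtain ⟨r, har, hrq, ⟨hpos, hmono, hlat⟩, hline⟩ :=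
    hP.exists_rigidPoint_of_hasRightSlope_zero hn hq h0
  have hm : δ * ⌊(q - r) / δ⌋ ≤ q - r := by
    have := Int.floor_le ((q - r) / δ)
    rwa [le_div_iff₀' hδ] at this
  have hm' : q - r < δ * ⌊(q - r) / δ⌋ + δ := by
    have := Int.lt_floor_add_one ((q - r) / δ)
    rw [div_lt_iff₀' hδ] at this
    linarith
  have hm0 : 0 ≤ δ * (⌊(q - r) / δ⌋ : ℝ) := by
    have : 0 ≤ ⌊(q - r) / δ⌋ := Int.floor_nonneg.2 (div_nonneg (sub_nonneg.2 hrq) hδ.le)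
    have : (0 : ℝ) ≤ ⌊(q - r) / δ⌋ := by exact_mod_cast this
    positivity
  set m := ⌊(q - r) / δ⌋ with hmdef
  have hrs : r ≤ r + δ * m := by linarith
  have hsq : r + δ * m ≤ q := by linarith
  have hPs := hline (r + δ * m) ⟨hrs, hsq⟩
  have hPq := hline q ⟨hrq, le_rfl⟩
  have hge : ∀ i, P r i ≤ P (r + δ * m) i := hP.apply_le_apply har hrs
  have happ : ∀ i : Fin n, (i : ℕ) ≠ 0 → P (r + δ * m) i = P r i := fun i hi => by
    rw [hPs]; simp [eVec_of_ne hi]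
  have hqlt : ∀ j : Fin n, (j : ℕ) ≠ 0 → P q ⟨0, hn⟩ < P q j := by
    intro j hj
    have h : ∀ᶠ t in 𝓝[>] q, P t = P q + (t - q) • eVec n 0 :=
      nhdsWithin_mono q Ioi_subset_Ici_self h0
    obtain ⟨t, ht, hqt⟩ := (h.and self_mem_nhdsWithin).exists
    have hqt : q < t := hqt
    have h1 := hP.mono t (hq.trans hqt.le) (show (⟨0, hn⟩ : Fin n) ≤ j from Nat.zero_le _)
    rw [ht] at h1
    simp only [Pi.add_apply, Pi.smul_apply, smul_eq_mul, eVec_of_ne hj] at h1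
    rw [eVec_self ⟨0, hn⟩] at h1
    linarith
  refine ⟨r + δ * m, har.trans hrs, hsq, by linarith, ⟨fun i => (hpos i).trans_le (hge i),
    fun i j hij => ?_, fun i => ?_⟩, ?_⟩
  · have hj : (j : ℕ) ≠ 0 := (Nat.zero_le i).trans_lt hij |>.ne'
    rw [happ j hj]
    by_cases hi : (i : ℕ) = 0
    · obtain rfl : i = ⟨0, hn⟩ := Fin.ext hi
      refine (hP.apply_le_apply (har.trans hrs) hsq _).trans_lt ((hqlt j hj).trans_eq ?_)
      rw [hPq]; simp [eVec_of_ne hj]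
    · rw [happ i hi]; exact hmono hij
  · obtain ⟨z, hz⟩ := hlat i
    by_cases hi : (i : ℕ) = 0
    · refine ⟨z + m, ?_⟩
      rw [hPs]
      simp only [Pi.add_apply, Pi.smul_apply, smul_eq_mul, hz]
      simp [eVec, hi]
      ring
    · exact ⟨z, by rw [happ i hi, hz]⟩
  · rcases eq_or_lt_of_le hsq with h | h
    · rwa [h]
    · filter_upwards [Icc_mem_nhdsGE h] with t ht
      rw [hline t ⟨hrs.trans ht.1, ht.2⟩, hPs, add_assoc, ← add_smul]
      ring_nf

end IsHalfLineRigid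

/-- An increasing homeomorphism of the line which preserves `δℤ` and stays within bounded distance
of the multiplication by `m`. -/
structure IsDistortion (δ : ℝ) (m E : ℕ) (φ : ℝ → ℝ) : Prop where
  continuous : Continuous φ
  strictMono : StrictMono φ
  one_le : 1 ≤ m
  lattice : ∀ z : ℤ, ∃ w : ℤ, φ (δ * z) = δ * w
  close : ∀ v, |φ v - m * v| ≤ E * δ
  eventually_affine : ∃ V, ∀ v w, V ≤ v → V ≤ w → φ w - φ v = m * (w - v)

theorem IsDistortion.isRigidPoint {m E : ℕ} {φ : ℝ → ℝ} (hφ : IsDistortion δ m E φ)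
    {y : RVec n} (hy : IsRigidPoint δ y) (hpos : ∀ i, 0 < φ (y i)) :
    IsRigidPoint δ (fun i => φ (y i)) := by
  refine ⟨hpos, fun i j hij => hφ.strictMono (hy.2.1 hij), fun i => ?_⟩
  obtain ⟨z, hz⟩ := hy.2.2 i
  obtain ⟨w, hw⟩ := hφ.lattice z
  exact ⟨w, by simpa only [hz] using hw⟩

theorem comp_eq_add_smul_eVec {y z : RVec n} {c : ℝ} {k : Fin n} (h : z = y + c • eVec n k)
    (φ : ℝ → ℝ) : (fun i => φ (z i)) =
      (fun i => φ (y i)) + (∑ i, φ (z i) - ∑ i, φ (y i)) • eVec n k := by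
  have hne : ∀ i, i ≠ k → z i = y i := fun i hi => by
    rw [h]; simp [eVec_of_ne (fun h => hi (Fin.ext h) : (i : ℕ) ≠ k)]
  have hsum : ∑ i, φ (z i) - ∑ i, φ (y i) = φ (z k) - φ (y k) := by
    rw [← Finset.sum_sub_distrib]
    refine Finset.sum_eq_single k (fun i _ hi => ?_) (by simp)
    rw [hne i hi, sub_self]
  funext i
  simp only [Pi.add_apply, Pi.smul_apply, smul_eq_mul, hsum]
  by_cases hi : i = k
  · rw [hi, eVec_self]; ring
  · rw [hne i hi, eVec_of_ne (fun h => hi (Fin.ext h) : (i : ℕ) ≠ k)]; ring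

namespace IsHalfLineRigid

variable {a : ℝ} {P : ℝ → RVec n}

theorem strictMonoOn_sum_comp (hP : IsHalfLineRigid n δ a P) {φ : ℝ → ℝ} (hφ : StrictMono φ) :
    StrictMonoOn (fun s => ∑ i, φ (P s i)) (Ici a) := by
  intro s hs u hu hsu
  refine Finset.sum_lt_sum (fun i _ => hφ.monotone (hP.apply_le_apply hs hsu.le i)) ?_
  by_contra! hcon
  have : ∑ i, P u i ≤ ∑ i, P s i :=
    Finset.sum_le_sum fun i hi => hφ.le_iff_le.1 (hcon i hi)
  rw [hP.sum u hu, hP.sum s hs] at this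
  exact hsu.not_ge this

theorem continuousOn_sum_comp (hP : IsHalfLineRigid n δ a P) {φ : ℝ → ℝ} (hφ : Continuous φ) :
    ContinuousOn (fun s => ∑ i, φ (P s i)) (Ici a) :=
  continuousOn_finsetSum _ fun i _ =>
    hφ.comp_continuousOn ((continuous_apply i).comp_continuousOn hP.continuousOn)

theorem abs_sum_comp_sub_le (hP : IsHalfLineRigid n δ a P) {m E : ℕ} {φ : ℝ → ℝ}
    (hφ : IsDistortion δ m E φ) {s : ℝ} (hs : a ≤ s) :
    |∑ i, φ (P s i) - m * s| ≤ n * (E * δ) := by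
  have h : ∑ i, φ (P s i) - m * s = ∑ i, (φ (P s i) - m * P s i) := by
    rw [Finset.sum_sub_distrib, ← Finset.mul_sum, hP.sum s hs]
  rw [h]
  refine (Finset.abs_sum_le_sum_abs _ _).trans
    ((Finset.sum_le_sum fun i _ => hφ.close (P s i)).trans_eq ?_)
  simp

theorem tendsto_sum_comp (hP : IsHalfLineRigid n δ a P) {m E : ℕ} {φ : ℝ → ℝ}
    (hφ : IsDistortion δ m E φ) : Tendsto (fun s => ∑ i, φ (P s i)) atTop atTop := by
  refine tendsto_atTop_mono' atTop (f₁ := fun s => s + -(n * (E * δ))) ?_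
    (tendsto_atTop_add_const_right _ _ tendsto_id)
  filter_upwards [eventually_ge_atTop a] with s hs
  have h1 := (abs_le.1 (hP.abs_sum_comp_sub_le hφ hs)).1
  have h2 : (1 : ℝ) ≤ m := by exact_mod_cast hφ.one_le
  have h3 : 0 < s := hP.pos.trans_le hs
  nlinarith

/-- Distorting the components of a proper rigid system and reparametrizing yields a proper rigid
system. -/
theorem exists_distortion (hP : IsHalfLineRigid n δ a P) (hn : 0 < n) {m E : ℕ} {φ : ℝ → ℝ}
    (hφ : IsDistortion δ m E φ) (hpos : ∀ i, 0 < φ (P a i)) :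
    ∃ Q : ℝ → RVec n, IsHalfLineRigid n δ (∑ i, φ (P a i)) Q ∧
      (∀ s, a ≤ s → Q (∑ i, φ (P s i)) = fun i => φ (P s i)) ∧
      ∀ s, a ≤ s → ∀ k : Fin n, HasRightSlope P s k →
        HasRightSlope Q (∑ i, φ (P s i)) k := by
  set τ : ℝ → ℝ := fun s => ∑ i, φ (P s i) with hτ
  have hmono : StrictMonoOn τ (Ici a) := hP.strictMonoOn_sum_comp hφ.strictMono
  have hcont : ContinuousOn τ (Ici a) := hP.continuousOn_sum_comp hφ.continuous
  have hIcc : ∀ {s u}, a ≤ s → s ≤ u → ∀ t ∈ Icc (τ s) (τ u), ∃ v ∈ Icc s u, τ v = t :=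
    fun hs hsu t ht =>
      intermediate_value_Icc hsu (hcont.mono fun v hv => hs.trans hv.1) ht
  have hsurj : ∀ t, τ a ≤ t → ∃ s, a ≤ s ∧ τ s = t := fun t ht => by
    obtain ⟨u, hu, hau⟩ := ((hP.tendsto_sum_comp hφ).eventually_ge_atTop t |>.and
      (eventually_ge_atTop a)).exists
    obtain ⟨v, hv, hvt⟩ := hIcc le_rfl hau t ⟨ht, hu⟩
    exact ⟨v, hv.1, hvt⟩
  choose! σ hσ hτσ using hsurj
  set Q : ℝ → RVec n := fun t i => φ (P (σ t) i) with hQ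
  have hτle : ∀ s, a ≤ s → τ a ≤ τ s := fun s hs => hmono.monotoneOn self_mem_Ici hs hs
  have hQτ : ∀ s, a ≤ s → Q (τ s) = fun i => φ (P s i) := fun s hs => by
    have : σ (τ s) = s := hmono.injOn (hσ _ (hτle s hs)) hs (hτσ _ (hτle s hs))
    simp only [hQ, this]
  have hright : ∀ s, a ≤ s → ∀ k : Fin n, HasRightSlope P s k → HasRightSlope Q (τ s) k := by
    intro s hs k hk
    obtain ⟨u, hsu, hk⟩ := mem_nhdsGE_iff_exists_Icc_subset.1 hk
    have hsu : s < u := hsu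
    filter_upwards [Icc_mem_nhdsGE (hmono hs (hs.trans hsu.le) hsu)] with t ht
    obtain ⟨v, hv, rfl⟩ := hIcc hs hsu.le t ht
    rw [hQτ s hs, hQτ v (hs.trans hv.1)]
    exact comp_eq_add_smul_eVec (hk hv) φ
  have hleft : ∀ s, a < s → ∀ k : Fin n, HasLeftSlope P s k → HasLeftSlope Q (τ s) k := by
    intro s hs k hk
    obtain ⟨ε, hε, hk⟩ := (hasLeftSlope_iff hs).1 hk
    have hu : max a (s - ε) < s := max_lt hs (by linarith)
    have hau : a ≤ max a (s - ε) := le_max_left _ _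
    filter_upwards [Icc_mem_nhdsLE (hmono hau hs.le hu)] with t ht
    obtain ⟨v, hv, rfl⟩ := hIcc hau hu.le t ht
    rw [hQτ s hs.le, hQτ v (hau.trans hv.1)]
    exact comp_eq_add_smul_eVec
      (hk v ⟨hau.trans hv.1, (le_max_right _ _).trans hv.1, hv.2⟩) φ
  have hφpos : ∀ s, a ≤ s → ∀ i, 0 < φ (P s i) := fun s hs i =>
    (hpos i).trans_le (hφ.strictMono.monotone (hP.apply_le_apply le_rfl hs i))
  have hlift : ∀ t, τ a ≤ t → ∃ s, a ≤ s ∧ t = τ s := fun t ht => ⟨σ t, hσ t ht, (hτσ t ht).symm⟩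
  have hlift' : ∀ t, τ a < t → ∃ s, a < s ∧ t = τ s := fun t ht => by
    obtain ⟨s, hs, rfl⟩ := hlift t ht.le
    exact ⟨s, lt_of_le_of_ne hs fun h => by simp [h] at ht, rfl⟩
  refine ⟨Q, ⟨?_, ?_, ?_, ?_, ?_, ?_, ?_, ?_, ?_, ?_⟩, hQτ, hright⟩
  · have : Nonempty (Fin n) := ⟨⟨0, hn⟩⟩
    exact Finset.sum_pos (fun i _ => hpos i) Finset.univ_nonempty
  · intro t ht i
    exact (hφpos _ (hσ t ht) i).le
  · intro t ht i j hij
    exact hφ.strictMono.monotone (hP.mono _ (hσ t ht) hij)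
  · intro t ht
    exact hτσ t ht
  · intro t ht
    obtain ⟨s, hs, rfl⟩ := hlift t ht
    obtain ⟨k, hk⟩ := hP.right s hs
    exact ⟨k, hright s hs k hk⟩
  · intro t ht
    obtain ⟨s, hs, rfl⟩ := hlift' t ht
    obtain ⟨k, hk⟩ := hP.left s hs
    exact ⟨k, hleft s hs k hk⟩
  · intro t ht k l hk hl hlk
    obtain ⟨s, hs, rfl⟩ := hlift' t ht
    obtain ⟨k', hk'⟩ := hP.right s hs.le
    obtain ⟨l', hl'⟩ := hP.left s hs
    obtain rfl : k = k' := Fin.ext (hk.unique (hright s hs.le k' hk'))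
    obtain rfl : l = l' := Fin.ext (hl.unique (hleft s hs l' hl'))
    rw [hQτ s hs.le]
    simp only [hP.eq_of_lt s hs k l hk' hl' hlk]
  · intro t ht k l hk hl hkl
    obtain ⟨s, hs, rfl⟩ := hlift' t ht
    obtain ⟨k', hk'⟩ := hP.right s hs.le
    obtain ⟨l', hl'⟩ := hP.left s hs
    obtain rfl : k = k' := Fin.ext (hk.unique (hright s hs.le k' hk'))
    obtain rfl : l = l' := Fin.ext (hl.unique (hleft s hs l' hl'))
    rw [hQτ s hs.le]
    exact hφ.isRigidPoint (hP.rigidPoint_of_lt s hs k l hk' hl' hkl) (hφpos s hs.le)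
  · rw [hQτ a le_rfl]
    exact hφ.isRigidPoint hP.rigidPoint_start hpos
  · intro M
    obtain ⟨s, h1, hs⟩ := ((hP.eventually_lt_apply (max 0 (M + E * δ))).and
      (eventually_ge_atTop a)).exists
    refine ⟨τ s, hτle s hs, fun i => ?_⟩
    rw [hQτ s hs]
    have h2 := (abs_le.1 (hφ.close (P s i))).1
    have h3 : (1 : ℝ) ≤ m := by exact_mod_cast hφ.one_le
    have h4 := (le_max_left _ _).trans_lt (h1 i)
    have h5 := (le_max_right _ _).trans_lt (h1 i)
    change M < φ (P s i)
    nlinarith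

end IsHalfLineRigid

theorem exists_isDistortion_apply_eq (hn : 0 < n) (hδ : 0 < δ) {b y : Fin n → ℝ}
    (hb : StrictMono b) (hbz : ∀ i, ∃ z : ℤ, b i = δ * z) (hyz : ∀ i, ∃ z : ℤ, y i = δ * z)
    (hgap : ∀ i j, i ≤ j → y i - b i ≤ y j - b j) {m E : ℕ} (hm : 2 ≤ m)
    (hclose : ∀ i, |y i - m * b i| ≤ E * δ) :
    ∃ φ, IsDistortion δ m E φ ∧ ∀ i, φ (b i) = y i := by
  have hne : (Finset.univ : Finset (Fin n)).Nonempty := ⟨⟨0, hn⟩, Finset.mem_univ _⟩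
  have hm' : (2 : ℝ) ≤ m := by exact_mod_cast hm
  set c : Fin n → ℝ := fun i => y i - b i with hc
  have hcsum : ∀ i, |c i| ≤ ∑ j, |c j| := fun i =>
    Finset.single_le_sum (f := fun j => |c j|) (fun j _ => abs_nonneg _) (Finset.mem_univ i)
  obtain ⟨K, hK⟩ := exists_nat_ge (max (m : ℝ) (2 * (∑ j, |c j|) / δ))
  have hKm : (m : ℝ) ≤ K := (le_max_left _ _).trans hK
  have hKδ : 2 * (∑ j, |c j|) ≤ K * δ := by
    have := (le_max_right _ _).trans hK
    rwa [div_le_iff₀ hδ] at this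
  have hbgap : ∀ i j, i < j → b i + δ ≤ b j := fun i j hij => by
    obtain ⟨z, hz⟩ := hbz i
    obtain ⟨w, hw⟩ := hbz j
    have h := hb hij
    rw [hz, hw] at h ⊢
    have h1 : z < w := by exact_mod_cast lt_of_mul_lt_mul_left h hδ.le
    have h2 : (z : ℝ) + 1 ≤ w := by exact_mod_cast h1
    nlinarith
  have hcb : ∀ i, |c i - (m - 1) * b i| ≤ E * δ := fun i => by
    have : c i - (m - 1) * b i = y i - m * b i := by simp only [hc]; ring
    rw [this]; exact hclose i
  set f : Fin n → ℝ → ℝ := fun i v => min (c i) (c i + K * (v - b i)) with hf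
  set g : ℝ → ℝ := fun v => Finset.univ.sup' hne fun i => f i v with hg
  set h : ℝ → ℝ := fun v => max ((m - 1) * v - E * δ) (g v) with hh
  have hfc : ∀ i v, f i v ≤ c i := fun i v => min_le_left _ _
  have hgle : ∀ v M, (∀ i, f i v ≤ M) → g v ≤ M := fun v M hM =>
    Finset.sup'_le hne _ fun i _ => hM i
  have hfmono : ∀ i, Monotone (f i) := fun i v w hvw => by
    refine min_le_min le_rfl ?_
    gcongr
  have hgmono : Monotone g := fun v w hvw =>
    Finset.sup'_mono_fun fun i _ => hfmono i hvw
  have hhmono : Monotone h := fun v w hvw => by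
    refine max_le_max ?_ (hgmono hvw)
    have : 0 ≤ (m : ℝ) - 1 := by linarith
    gcongr
  have hhle : ∀ v, h v ≤ (m - 1) * v + E * δ := fun v => by
    refine max_le (by have : 0 ≤ E * δ := by positivity
                      linarith) (hgle _ _ fun i => ?_)
    have h1 := (abs_le.1 (hcb i)).2
    rcases le_total (b i) v with hv | hv
    · refine (hfc i v).trans ?_
      nlinarith
    · refine (min_le_right _ _).trans ?_
      nlinarith
  have hhb : ∀ i, h (b i) = c i := fun i => by
    refine le_antisymm (max_le ?_ (hgle _ _ fun j => ?_)) ?_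
    · linarith [(abs_le.1 (hcb i)).1]
    · rcases le_or_gt j i with hji | hij
      · exact (hfc j _).trans (hgap j i hji)
      · refine (min_le_right _ _).trans ?_
        have h1 := hbgap i j hij
        have h2 := (abs_le.1 (hcsum i)).1
        have h3 := (abs_le.1 (hcsum j)).2
        have h4 : (K : ℝ) * (b i - b j) ≤ K * (-δ) := by
          gcongr; linarith
        linarith
    · refine le_max_of_le_right ?_
      have : f i (b i) = c i := by simp [hf]
      exact this.symm.le.trans (Finset.le_sup' (fun j => f j (b i)) (Finset.mem_univ i))
  refine ⟨fun v => v + h v, ⟨?_, fun v w hvw => add_lt_add_of_lt_of_le hvw (hhmono hvw.le),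
    by omega, fun z => ?_, fun v => ?_, ⟨∑ j, |c j| + E * δ, fun v w hv hw => ?_⟩⟩, fun i => ?_⟩
  · refine continuous_id.add (Continuous.max (by fun_prop) ?_)
    refine Continuous.finset_sup'_apply hne fun i _ => ?_
    exact Continuous.min (by fun_prop) (by fun_prop)
  · have hmax : h (δ * z) = (m - 1) * (δ * z) - E * δ ∨ h (δ * z) = g (δ * z) := max_choice _ _
    rcases hmax with h1 | h1
    · exact ⟨z + ((m - 1) * z - E), by rw [h1]; push_cast; ring⟩
    · obtain ⟨i, -, hi⟩ := Finset.exists_mem_eq_sup' hne fun i => f i (δ * z)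
      obtain ⟨p, hp⟩ := hbz i
      obtain ⟨q, hq⟩ := hyz i
      have hi' : h (δ * z) = f i (δ * z) := h1.trans hi
      have hmin : f i (δ * z) = c i ∨ f i (δ * z) = c i + K * (δ * z - b i) := min_choice _ _
      rcases hmin with h2 | h2
      · exact ⟨z + (q - p), by rw [hi', h2]; simp only [hc, hp, hq]; push_cast; ring⟩
      · exact ⟨z + (q - p + K * (z - p)), by
          rw [hi', h2]; simp only [hc, hp, hq]; push_cast; ring⟩
  · have h1 := hhle v
    have h2 : (m - 1) * v - E * δ ≤ h v := le_max_left _ _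
    rw [abs_le]
    constructor <;> linarith
  · have haff : ∀ v, ∑ j, |c j| + E * δ ≤ v → h v = (m - 1) * v - E * δ := fun v hv => by
      refine max_eq_left (hgle _ _ fun i => (hfc i v).trans ?_)
      have h1 := (abs_le.1 (hcsum i)).2
      have h2 : 0 ≤ ∑ j, |c j| := Finset.sum_nonneg fun j _ => abs_nonneg _
      have h3 : 0 ≤ E * δ := by positivity
      nlinarith
    rw [haff v hv, haff w hw]
    ring
  · change b i + h (b i) = y i
    rw [hhb i]
    simp [hc]

theorem isDistortion_mul {m : ℕ} (hm : 1 ≤ m) : IsDistortion δ m 0 (fun v => m * v) where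
  continuous := by fun_prop
  strictMono v w hvw := by
    have : (0 : ℝ) < m := by exact_mod_cast hm
    exact mul_lt_mul_of_pos_left hvw this
  one_le := hm
  lattice z := ⟨m * z, by push_cast; ring⟩
  close v := by simp
  eventually_affine := ⟨0, fun v w _ _ => by ring⟩

/-- Proper rigid systems which meet with direction `e_1` at successive numbers `T i` can be glued
together. -/
theorem exists_isHalfLineRigid_glue {T : ℕ → ℝ} {P : ℕ → ℝ → RVec n}
    (hT : StrictMono T) (hT' : Tendsto T atTop atTop)
    (hP : ∀ i, IsHalfLineRigid n δ (T i) (P i))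
    (hglue : ∀ i, P i (T (i + 1)) = P (i + 1) (T (i + 1)))
    (hslope : ∀ i, HasRightSlope (P i) (T i) 0)
    (hub : ∀ M : ℝ, ∃ i, ∀ j, M < P i (T i) j) :
    ∃ S : ℝ → RVec n, IsHalfLineRigid n δ (T 0) S ∧
      ∀ i, ∀ t ∈ Icc (T i) (T (i + 1)), S t = P i t := by
  have hex : ∀ t, T 0 ≤ t → ∃ i, t ∈ Ico (T i) (T (i + 1)) := fun t ht => by
    have hlt : ∃ i, t < T i := (hT'.eventually_gt_atTop t).exists
    classical
    have h0 : Nat.find hlt ≠ 0 := fun h => by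
      have := Nat.find_spec hlt
      rw [h] at this
      exact this.not_ge ht
    obtain ⟨k, hk⟩ := Nat.exists_eq_succ_of_ne_zero h0
    refine ⟨k, not_lt.1 (Nat.find_min hlt (by omega)), ?_⟩
    have := Nat.find_spec hlt
    rwa [hk] at this
  have hidx : ∀ i j t, t ∈ Ico (T i) (T (i + 1)) → t ∈ Ico (T j) (T (j + 1)) → i = j := by
    intro i j t hi hj
    have h1 := hT.lt_iff_lt.1 (hi.1.trans_lt hj.2)
    have h2 := hT.lt_iff_lt.1 (hj.1.trans_lt hi.2)
    omega
  choose! ι hι using hex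
  set S : ℝ → RVec n := fun t => P (ι t) t with hS
  have hT0 : ∀ i, T 0 ≤ T i := fun i => hT.monotone (Nat.zero_le i)
  have hSI : ∀ i, ∀ t ∈ Ico (T i) (T (i + 1)), S t = P i t := fun i t ht => by
    rw [hS, hidx i (ι t) t ht (hι t ((hT0 i).trans ht.1))]
  have hSI' : ∀ i, ∀ t ∈ Icc (T i) (T (i + 1)), S t = P i t := fun i t ht => by
    rcases eq_or_lt_of_le ht.2 with h | h
    · rw [h, hglue, hSI (i + 1) _ ⟨le_rfl, hT (Nat.lt_succ_self _)⟩]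
    · exact hSI i t ⟨ht.1, h⟩
  have hr : ∀ i, ∀ t ∈ Ico (T i) (T (i + 1)), ∀ k : ℕ, HasRightSlope (P i) t k →
      HasRightSlope S t k := by
    intro i t ht k hk
    filter_upwards [hk, Icc_mem_nhdsGE ht.2] with u hu htu
    rw [hSI' i u ⟨ht.1.trans htu.1, htu.2⟩, hSI i t ht, hu]
  have hl : ∀ i, ∀ t ∈ Ioc (T i) (T (i + 1)), ∀ k : ℕ, HasLeftSlope (P i) t k →
      HasLeftSlope S t k := by
    intro i t ht k hk
    filter_upwards [hk, Icc_mem_nhdsLE ht.1] with u hu htu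
    rw [hSI' i u ⟨htu.1, htu.2.trans ht.2⟩, hSI' i t ⟨ht.1.le, ht.2⟩, hu]
  have hcases : ∀ t, T 0 < t → (∃ i, t ∈ Ioo (T i) (T (i + 1))) ∨ ∃ i, t = T (i + 1) := by
    intro t ht
    have := hι t ht.le
    rcases eq_or_lt_of_le this.1 with h | h
    · refine Or.inr ⟨ι t - 1, ?_⟩
      have h0 : ι t ≠ 0 := fun h0 => by rw [h0] at h; exact ht.ne h
      rw [Nat.sub_add_cancel (Nat.pos_of_ne_zero h0), h]
    · exact Or.inl ⟨ι t, h, this.2⟩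
  have hstep : ∀ i, T i < T (i + 1) := fun i => hT (Nat.lt_succ_self i)
  have hST : ∀ i, S (T i) = P i (T i) := fun i => hSI i _ ⟨le_rfl, hstep i⟩
  refine ⟨S, ⟨(hP 0).pos, ?_, ?_, ?_, ?_, ?_, ?_, ?_, ?_, ?_⟩, hSI'⟩
  · exact fun t ht => (hP (ι t)).nonneg t (hι t ht).1
  · exact fun t ht => (hP (ι t)).mono t (hι t ht).1
  · exact fun t ht => (hP (ι t)).sum t (hι t ht).1
  · intro t ht
    obtain ⟨k, hk⟩ := (hP (ι t)).right t (hι t ht).1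
    exact ⟨k, hr _ t (hι t ht) k hk⟩
  · intro t ht
    rcases hcases t ht with ⟨i, hi⟩ | ⟨i, rfl⟩
    · obtain ⟨k, hk⟩ := (hP i).left t hi.1
      exact ⟨k, hl i t ⟨hi.1, hi.2.le⟩ k hk⟩
    · obtain ⟨k, hk⟩ := (hP i).left _ (hstep i)
      exact ⟨k, hl i _ ⟨hstep i, le_rfl⟩ k hk⟩
  · intro t ht k l hk hkl hlk
    rcases hcases t ht with ⟨i, hi⟩ | ⟨i, rfl⟩
    · obtain ⟨k', hk'⟩ := (hP i).right t hi.1.le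
      obtain ⟨l', hl'⟩ := (hP i).left t hi.1
      obtain rfl : k = k' := Fin.ext (hk.unique (hr i t ⟨hi.1.le, hi.2⟩ k' hk'))
      obtain rfl : l = l' := Fin.ext (hkl.unique (hl i t ⟨hi.1, hi.2.le⟩ l' hl'))
      rw [hSI i t ⟨hi.1.le, hi.2⟩]
      exact (hP i).eq_of_lt t hi.1 k l hk' hl' hlk
    · have h0 := hk.unique (hr (i + 1) _ ⟨le_rfl, hstep _⟩ 0 (hslope (i + 1)))
      exact absurd (Fin.lt_def.1 hlk) (by omega)
  · intro t ht k l hk hkl hlk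
    rcases hcases t ht with ⟨i, hi⟩ | ⟨i, rfl⟩
    · obtain ⟨k', hk'⟩ := (hP i).right t hi.1.le
      obtain ⟨l', hl'⟩ := (hP i).left t hi.1
      obtain rfl : k = k' := Fin.ext (hk.unique (hr i t ⟨hi.1.le, hi.2⟩ k' hk'))
      obtain rfl : l = l' := Fin.ext (hkl.unique (hl i t ⟨hi.1, hi.2.le⟩ l' hl'))
      rw [hSI i t ⟨hi.1.le, hi.2⟩]
      exact (hP i).rigidPoint_of_lt t hi.1 k l hk' hl' hlk
    · rw [hST]
      exact (hP (i + 1)).rigidPoint_start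
  · rw [hST]
    exact (hP 0).rigidPoint_start
  · intro M
    obtain ⟨i, hi⟩ := hub M
    exact ⟨T i, hT0 i, fun j => by rw [hST]; exact hi j⟩

theorem mem_FSet_iff {I : Set ℝ} {P : ℝ → RVec n} {x : RVec n} :
    x ∈ FSet n I P ↔ ∀ ε > 0, ∀ M, ∃ q ∈ I, M ≤ q ∧ dist (q⁻¹ • P q) x < ε := by
  constructor
  · rintro ⟨q, hqI, -, hq, hlim⟩ ε hε M
    obtain ⟨i, h1, h2⟩ := ((hq.eventually_ge_atTop M).and
      (hlim.eventually (Metric.ball_mem_nhds x hε))).exists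
    exact ⟨q i, hqI i, h1, h2⟩
  · intro h
    choose q hqI hq hdist using fun k : ℕ => h (1 / (k + 1)) (by positivity) k
    have hqT : Tendsto q atTop atTop := tendsto_atTop_mono hq tendsto_natCast_atTop_atTop
    have hlim : Tendsto (fun k => (q k)⁻¹ • P (q k)) atTop (𝓝 x) :=
      tendsto_iff_dist_tendsto_zero.2 (squeeze_zero (fun _ => dist_nonneg) (fun k => (hdist k).le)
        tendsto_one_div_add_atTop_nhds_zero_nat)
    obtain ⟨φ, hφ, hφq⟩ := strictMono_subseq_of_tendsto_atTop hqT
    exact ⟨q ∘ φ, fun k => hqI _, hφq, hqT.comp hφ.tendsto_atTop, hlim.comp hφ.tendsto_atTop⟩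

theorem mem_setLimsup_iff {F : ℕ → Set (RVec n)} (hF : ∀ i, (F i).Nonempty) {x : RVec n} :
    x ∈ setLimsup n F ↔ ∀ ε > 0, ∀ N, ∃ i, N ≤ i ∧ ∃ y ∈ F i, dist y x < ε := by
  constructor
  · rintro ⟨y, φ, hy, hφ, hlim⟩ ε hε N
    obtain ⟨k, h1, h2⟩ := ((hφ.tendsto_atTop.eventually_ge_atTop N).and
      (hlim.eventually (Metric.ball_mem_nhds x hε))).exists
    exact ⟨φ k, h1, y (φ k), hy _, h2⟩
  · intro h
    choose ι hι y hy hdist using fun k : ℕ => h (1 / (k + 1)) (by positivity) k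
    have hιT : Tendsto ι atTop atTop := tendsto_atTop_mono hι tendsto_id
    have hlim : Tendsto y atTop (𝓝 x) :=
      tendsto_iff_dist_tendsto_zero.2 (squeeze_zero (fun _ => dist_nonneg) (fun k => (hdist k).le)
        tendsto_one_div_add_atTop_nhds_zero_nat)
    obtain ⟨ψ, hψ, hψι⟩ := strictMono_subseq_of_tendsto_atTop hιT
    choose z hz using hF
    refine ⟨Function.extend (ι ∘ ψ) (y ∘ ψ) z, ι ∘ ψ, fun i => ?_, hψι, ?_⟩
    · by_cases hi : ∃ k, (ι ∘ ψ) k = i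
      · obtain ⟨k, rfl⟩ := hi
        rw [hψι.injective.extend_apply]
        exact hy (ψ k)
      · rw [Function.extend_apply' _ _ _ hi]
        exact hz i
    · rw [show Function.extend (ι ∘ ψ) (y ∘ ψ) z ∘ (ι ∘ ψ) = y ∘ ψ from
        funext fun k => hψι.injective.extend_apply _ _ k]
      exact hlim.comp hψ.tendsto_atTop

theorem abs_div_sub_div_le {u v s t m e e' : ℝ} (ht : 0 < t) (hs : 0 < s) (hv : 0 ≤ v)
    (hvs : v ≤ s) (hu : |u - m * v| ≤ e) (hts : |t - m * s| ≤ e') :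
    |u / t - v / s| ≤ (e + e') / t := by
  have h : u / t - v / s = ((u - m * v) - v / s * (t - m * s)) / t := by
    field_simp
    ring
  rw [h, abs_div, abs_of_pos ht]
  refine div_le_div_of_nonneg_right ((abs_sub _ _).trans (add_le_add hu ?_)) ht.le
  rw [abs_mul, abs_of_nonneg (div_nonneg hv hs.le)]
  exact (mul_le_of_le_one_left (abs_nonneg _) ((div_le_one hs).2 hvs)).trans hts

namespace IsHalfLineRigid

variable {a : ℝ} {P : ℝ → RVec n}

theorem dist_inv_smul_le (hP : IsHalfLineRigid n δ a P) {s t m e e' : ℝ} {y : RVec n}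
    (hs : a ≤ s) (ht : 0 < t) (he : 0 ≤ e) (hy : ∀ i, |y i - m * P s i| ≤ e)
    (hts : |t - m * s| ≤ e') :
    dist (t⁻¹ • y) (s⁻¹ • P s) ≤ (e + e') / t := by
  have he' : 0 ≤ e' := (abs_nonneg _).trans hts
  refine (dist_pi_le_iff (by positivity)).2 fun i => ?_
  rw [Real.dist_eq]
  simp only [Pi.smul_apply, smul_eq_mul, ← div_eq_inv_mul]
  exact abs_div_sub_div_le ht (hP.pos.trans_le hs) (hP.nonneg s hs i) (hP.apply_le hs i) (hy i) hts

theorem inv_smul_mem_Icc (hP : IsHalfLineRigid n δ a P) {s : ℝ} (hs : a ≤ s) :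
    s⁻¹ • P s ∈ Icc (0 : RVec n) 1 := by
  have hs0 := hP.pos.trans_le hs
  constructor <;> intro i <;> simp only [Pi.smul_apply, smul_eq_mul, ← div_eq_inv_mul]
  · exact div_nonneg (hP.nonneg s hs i) hs0.le
  · exact (div_le_one hs0).2 (hP.apply_le hs i)

theorem exists_forall_dist_FSet_lt (hP : IsHalfLineRigid n δ a P) {η : ℝ} (hη : 0 < η) :
    ∃ M, ∀ s, M ≤ s → ∃ y ∈ FSet n (Ici a) P, dist (s⁻¹ • P s) y < η := by
  by_contra! hcon
  choose s hs hfar using fun k : ℕ => hcon (max a k)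
  have has : ∀ k, a ≤ s k := fun k => (le_max_left _ _).trans (hs k)
  have hks : ∀ k : ℕ, (k : ℝ) ≤ s k := fun k => (le_max_right _ _).trans (hs k)
  obtain ⟨y, -, φ, hφ, hlim⟩ := (isCompact_Icc (a := (0 : RVec n)) (b := 1)).tendsto_subseq
    fun k => hP.inv_smul_mem_Icc (has k)
  have hsT : Tendsto s atTop atTop := tendsto_atTop_mono hks tendsto_natCast_atTop_atTop
  have hy : y ∈ FSet n (Ici a) P := mem_FSet_iff.2 fun ε hε M => by
    obtain ⟨k, h1, h2⟩ := (((hsT.comp hφ.tendsto_atTop).eventually_ge_atTop M).and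
      (hlim.eventually (Metric.ball_mem_nhds y hε))).exists
    exact ⟨s (φ k), has _, h1, h2⟩
  obtain ⟨k, hk⟩ := (hlim.eventually (Metric.ball_mem_nhds y hη)).exists
  exact (hfar (φ k) y hy).not_gt hk

theorem exists_forall_FSet_exists_dist_lt (hP : IsHalfLineRigid n δ a P) {η : ℝ} (hη : 0 < η) :
    ∃ Q, ∀ y ∈ FSet n (Ici a) P, ∃ s ∈ Icc a Q, dist (s⁻¹ • P s) y < η := by
  have hsub : (fun s => s⁻¹ • P s) '' Ici a ⊆ Icc (0 : RVec n) 1 := by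
    rintro _ ⟨s, hs, rfl⟩
    exact hP.inv_smul_mem_Icc hs
  have htb : TotallyBounded ((fun s => s⁻¹ • P s) '' Ici a) :=
    isCompact_Icc.totallyBounded.subset hsub
  obtain ⟨A, hA, hAfin, hcover⟩ := Metric.finite_approx_of_totallyBounded htb (η / 2) (half_pos hη)
  have hA' : ∀ z ∈ A, ∃ s, a ≤ s ∧ s⁻¹ • P s = z := fun z hz => hA hz
  choose! σ hσ hσA using hA'
  obtain ⟨Q, hQ⟩ := (hAfin.image σ).bddAbove
  refine ⟨Q, fun y hy => ?_⟩
  obtain ⟨q, hq, -, hdist⟩ := mem_FSet_iff.1 hy (η / 2) (half_pos hη) 0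
  obtain ⟨z, hz, hball⟩ := mem_iUnion₂.1 (hcover (mem_image_of_mem _ hq))
  refine ⟨σ z, ⟨hσ z hz, hQ (mem_image_of_mem σ hz)⟩, ?_⟩
  have h1 : dist ((σ z)⁻¹ • P (σ z)) (q⁻¹ • P q) < η / 2 := by
    rw [hσA z hz, dist_comm]
    exact hball
  linarith [dist_triangle ((σ z)⁻¹ • P (σ z)) (q⁻¹ • P q) y]

theorem frequently_rigidPoint (hP : IsHalfLineRigid n δ a P) (hn : 0 < n) (hδ : 0 < δ)
    {x : RVec n} (hx : x ∈ FSetE1 n (Ici a) P) {η : ℝ} (hη : 0 < η) :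
    ∃ᶠ q in atTop, IsRigidPoint δ (P q) ∧ HasRightSlope P q 0 ∧ dist (q⁻¹ • P q) x < η := by
  obtain ⟨q, hqa, -, hqT, hslope, hlim⟩ := hx
  rw [frequently_atTop]
  intro M
  obtain ⟨k, h1, h2⟩ := ((hqT.eventually_ge_atTop (max M (4 * δ / η) + δ)).and
    (hlim.eventually (Metric.ball_mem_nhds x (half_pos hη)))).exists
  have hk : a ≤ q k := hqa k
  obtain ⟨s, has, hsq, hqs, hrig, hs0⟩ :=
    hP.exists_rigidPoint_near hn hδ hk ((hasRightSlope_iff hk).2 (hslope k))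
  have hM : max M (4 * δ / η) ≤ s := by linarith
  refine ⟨s, (le_max_left _ _).trans hM, hrig, hs0, ?_⟩
  have hspos : 0 < s := hP.pos.trans_le has
  have h3 : dist (s⁻¹ • P s) ((q k)⁻¹ • P (q k)) ≤ (δ + δ) / s := by
    refine hP.dist_inv_smul_le (m := 1) hk hspos hδ.le (fun i => ?_) ?_
    · rw [one_mul, abs_sub_comm, abs_of_nonneg (sub_nonneg.2 (hP.apply_le_apply has hsq i))]
      refine (Finset.single_le_sum (f := fun i => P (q k) i - P s i)
        (fun i _ => sub_nonneg.2 (hP.apply_le_apply has hsq i)) (Finset.mem_univ i)).trans ?_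
      rw [Finset.sum_sub_distrib, hP.sum _ hk, hP.sum _ has]
      exact hqs
    · rw [one_mul, abs_sub_comm, abs_of_nonneg (sub_nonneg.2 hsq)]
      exact hqs
  have h4 : (δ + δ) / s ≤ η / 2 := by
    rw [div_le_iff₀ hspos]
    have := (le_max_right _ _).trans hM
    rw [div_le_iff₀ hη] at this
    linarith
  have h5 : dist ((q k)⁻¹ • P (q k)) x < η / 2 := h2
  linarith [dist_triangle (s⁻¹ • P s) ((q k)⁻¹ • P (q k)) x]

end IsHalfLineRigid

theorem IsRigidPoint.add_le {y : RVec n} (hδ : 0 < δ) (hy : IsRigidPoint δ y) {i j : Fin n}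
    (hij : i < j) : y i + δ ≤ y j := by
  obtain ⟨-, hmono, hz⟩ := hy
  have hlt := hmono hij
  obtain ⟨k, hk⟩ := hz i
  obtain ⟨l, hl⟩ := hz j
  rw [hk, hl] at hlt ⊢
  have hkl : k + 1 ≤ l := by exact_mod_cast lt_of_mul_lt_mul_left hlt hδ.le
  have hkl' : (k : ℝ) + 1 ≤ l := by exact_mod_cast hkl
  nlinarith

theorem FSet_Ici_eq {a b : ℝ} (hab : a ≤ b) (P : ℝ → RVec n) :
    FSet n (Ici b) P = FSet n (Ici a) P := by
  ext x
  rw [mem_FSet_iff, mem_FSet_iff]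
  constructor
  · intro h ε hε M
    obtain ⟨q, hq, h'⟩ := h ε hε M
    exact ⟨q, hab.trans hq, h'⟩
  · intro h ε hε M
    obtain ⟨q, -, hM, h'⟩ := h ε hε (max b M)
    exact ⟨q, (le_max_left _ _).trans hM, (le_max_right _ _).trans hM, h'⟩

theorem FSetE1_subset_FSet (I : Set ℝ) (P : ℝ → RVec n) : FSetE1 n I P ⊆ FSet n I P :=
  fun _ ⟨q, h1, h2, h3, _, h4⟩ => ⟨q, h1, h2, h3, h4⟩

theorem IsHalfLineRigid.exists_next_distortion {r r₂ : ℝ} {P P₂ : ℝ → RVec n}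
    (hP : IsHalfLineRigid n δ r P) (hP₂ : IsHalfLineRigid n δ r₂ P₂) (hn : 0 < n) (hδ : 0 < δ)
    {m E : ℕ} {φ : ℝ → ℝ} (hφ : IsDistortion δ m E φ) (hmr : r₂ ≤ m * δ)
    {l : RVec n} {u u₂ : ℝ} (hu : 0 < u) (hu₂ : 0 < u₂)
    (hfreq : ∃ᶠ q in atTop, IsRigidPoint δ (P q) ∧ HasRightSlope P q 0 ∧ dist (q⁻¹ • P q) l < u)
    (hl : dist (r₂⁻¹ • P₂ r₂) l < u₂) (K : ℝ) {C : ℝ → Prop} (hC : ∀ᶠ q in atTop, C q) :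
    ∃ (q : ℝ) (m₂ E₂ : ℕ) (φ₂ : ℝ → ℝ), r < q ∧ C q ∧ HasRightSlope P q 0 ∧
      IsDistortion δ m₂ E₂ φ₂ ∧ K ≤ m₂ * δ ∧ (∀ j, φ₂ (P₂ r₂ j) = φ (P q j)) ∧
      E₂ * δ ≤ (2 * u + 2 * u₂) * ∑ j, φ (P q j) := by
  obtain ⟨V, hV⟩ := hφ.eventually_affine
  have hr₂ := hP₂.pos
  have hT := hP.tendsto_sum_comp hφ
  obtain ⟨q, ⟨hrig, hslope, hq⟩, hrq, hCq, hVq, hT1, hT2, hT3, hT4⟩ :=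
    (hfreq.and_eventually ((eventually_gt_atTop r).and (hC.and ((hP.eventually_lt_apply V).and
      ((hT.eventually_ge_atTop ((n + 1) * (E * δ) / u)).and
      ((hT.eventually_ge_atTop ((r₂ + δ) / u₂)).and
      ((hT.eventually_ge_atTop (2 * r₂)).and (hT.eventually_ge_atTop (K / δ * r₂))))))))).exists
  set T := ∑ j, φ (P q j) with hTdef
  have hTpos : 0 < T := by linarith
  rw [div_le_iff₀ hu] at hT1
  rw [div_le_iff₀ hu₂] at hT2
  have hm₂ : T / r₂ ≤ ⌈T / r₂⌉₊ := Nat.le_ceil _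
  have hm₂' : ⌈T / r₂⌉₊ < T / r₂ + 1 := Nat.ceil_lt_add_one (by positivity)
  have hE₂ : (T * (2 * u + u₂) + r₂) / δ ≤ ⌈(T * (2 * u + u₂) + r₂) / δ⌉₊ := Nat.le_ceil _
  have hE₂' : ⌈(T * (2 * u + u₂) + r₂) / δ⌉₊ < (T * (2 * u + u₂) + r₂) / δ + 1 :=
    Nat.ceil_lt_add_one (by positivity)
  set m₂ := ⌈T / r₂⌉₊
  set E₂ := ⌈(T * (2 * u + u₂) + r₂) / δ⌉₊
  have hdist : dist (T⁻¹ • fun j => φ (P q j)) (q⁻¹ • P q) ≤ u := by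
    refine (hP.dist_inv_smul_le (m := m) (e := E * δ) hrq.le hTpos (by positivity)
      (fun i => hφ.close _) (hP.abs_sum_comp_sub_le hφ hrq.le)).trans ?_
    rw [div_le_iff₀ hTpos]
    linarith
  have hgap : ∀ i j, i ≤ j → φ (P q i) - P₂ r₂ i ≤ φ (P q j) - P₂ r₂ j := by
    intro i j hij
    rcases hij.eq_or_lt with rfl | hij
    · exact le_rfl
    · have h1 := hV (P q i) (P q j) (hVq i).le (hVq j).le
      have h2 := hrig.add_le hδ hij
      have h3 := hP₂.nonneg r₂ le_rfl i
      have h4 := hP₂.apply_le le_rfl j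
      have h5 : (m : ℝ) * δ ≤ m * (P q j - P q i) :=
        mul_le_mul_of_nonneg_left (by linarith) (Nat.cast_nonneg m)
      linarith
  have hclose : ∀ j, |φ (P q j) - m₂ * P₂ r₂ j| ≤ E₂ * δ := by
    intro j
    have h1 : |φ (P q j) / T - P₂ r₂ j / r₂| ≤ 2 * u + u₂ := by
      have h2 := dist_le_pi_dist (T⁻¹ • fun j => φ (P q j)) (r₂⁻¹ • P₂ r₂) j
      simp only [Pi.smul_apply, smul_eq_mul, ← div_eq_inv_mul, Real.dist_eq] at h2
      have h3 := dist_triangle4 (T⁻¹ • fun j => φ (P q j)) (q⁻¹ • P q) l (r₂⁻¹ • P₂ r₂)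
      rw [dist_comm l] at h3
      linarith
    have h2 : |P₂ r₂ j * (T / r₂ - m₂)| ≤ r₂ := by
      have h3 : |T / r₂ - m₂| ≤ 1 := abs_le.2 ⟨by linarith, by linarith⟩
      rw [abs_mul, abs_of_nonneg (hP₂.nonneg r₂ le_rfl j)]
      exact (mul_le_of_le_one_right (hP₂.nonneg r₂ le_rfl j) h3).trans (hP₂.apply_le le_rfl j)
    have h3 : φ (P q j) - m₂ * P₂ r₂ j =
        T * (φ (P q j) / T - P₂ r₂ j / r₂) + P₂ r₂ j * (T / r₂ - m₂) := by
      field_simp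
      ring
    rw [div_le_iff₀ hδ] at hE₂
    rw [h3]
    refine (abs_add_le _ _).trans ((add_le_add ?_ h2).trans hE₂)
    rw [abs_mul, abs_of_pos hTpos]
    exact mul_le_mul_of_nonneg_left h1 hTpos.le
  have hm2 : 2 ≤ m₂ := by
    have : (2 : ℝ) ≤ m₂ := ((le_div_iff₀ hr₂).2 hT3).trans hm₂
    exact_mod_cast this
  obtain ⟨φ₂, hφ₂, hφ₂b⟩ := exists_isDistortion_apply_eq hn hδ hP₂.rigidPoint_start.2.1
    hP₂.rigidPoint_start.2.2 (fun i => by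
      obtain ⟨z, hz⟩ := hrig.2.2 i
      rw [hz]
      exact hφ.lattice z) hgap hm2 hclose
  refine ⟨q, m₂, E₂, φ₂, hrq, hCq, hslope, hφ₂, ?_, hφ₂b, ?_⟩
  · exact (div_le_iff₀ hδ).1 (((le_div_iff₀ hr₂).2 hT4).trans hm₂)
  · have : E₂ * δ ≤ T * (2 * u + u₂) + r₂ + δ := by
      have := mul_le_mul_of_nonneg_right hE₂'.le hδ.le
      rwa [add_mul, div_mul_cancel₀ _ hδ.ne', one_mul] at this
    linarith

theorem exists_seq_of_forall_exists_succ {α : Type*} {p : ℕ → α → Prop} {r : ℕ → α → α → Prop}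
    (h0 : ∃ x, p 0 x) (hs : ∀ i x, p i x → ∃ y, p (i + 1) y ∧ r i x y) :
    ∃ f : ℕ → α, ∀ i, p i (f i) ∧ r i (f i) (f (i + 1)) := by
  choose g hg hr using hs
  obtain ⟨x₀, hx₀⟩ := h0
  let F : ∀ i, {x // p i x} := fun i =>
    Nat.rec ⟨x₀, hx₀⟩ (fun i x => ⟨g i x.1 x.2, hg i x.1 x.2⟩) i
  exact ⟨fun i => (F i).1, fun i => ⟨(F i).2, hr i (F i).1 (F i).2⟩⟩

theorem exists_composite (hn : 0 < n) (hδ : 0 < δ) {r : ℕ → ℝ} {P : ℕ → ℝ → RVec n}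
    (hP : ∀ i, IsHalfLineRigid n δ (r i) (P i)) (hslope : ∀ i, HasRightSlope (P i) (r i) 0)
    {l : RVec n} {u : ℕ → ℝ} (hu : ∀ i, 0 < u i)
    (hl : ∀ i, dist ((r i)⁻¹ • P i (r i)) l < u i)
    (hfreq : ∀ i, ∃ᶠ q in atTop,
      IsRigidPoint δ (P i q) ∧ HasRightSlope (P i) q 0 ∧ dist (q⁻¹ • P i q) l < u i)
    (Q : ℕ → ℝ) :
    ∃ (q T : ℕ → ℝ) (m E : ℕ → ℕ) (φ : ℕ → ℝ → ℝ) (S : ℝ → RVec n),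
      StrictMono T ∧ Tendsto T atTop atTop ∧ IsHalfLineRigid n δ (T 0) S ∧
      ∀ i, IsDistortion δ (m i) (E i) (φ i) ∧ r i < q i ∧ Q i ≤ q i ∧
        T i = ∑ j, φ i (P i (r i) j) ∧ T (i + 1) = ∑ j, φ i (P i (q i) j) ∧
        E (i + 1) * δ ≤ (2 * u i + 2 * u (i + 1)) * T (i + 1) ∧
        ∀ s ∈ Icc (r i) (q i), S (∑ j, φ i (P i s j)) = fun j => φ i (P i s j) := by
  let p : ℕ → ℕ × ℕ × (ℝ → ℝ) → Prop := fun i x =>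
    IsDistortion δ x.1 x.2.1 x.2.2 ∧ r (i + 1) ≤ x.1 * δ ∧ ∀ j, 0 < x.2.2 (P i (r i) j)
  let R : ℕ → ℕ × ℕ × (ℝ → ℝ) → ℕ × ℕ × (ℝ → ℝ) → Prop := fun i x y =>
    ∃ q, r i < q ∧ Q i ≤ q ∧ HasRightSlope (P i) q 0 ∧
      (∀ j, (i : ℝ) < x.2.2 (P i q j)) ∧ (i : ℝ) ≤ ∑ j, x.2.2 (P i q j) ∧
      (∀ j, y.2.2 (P (i + 1) (r (i + 1)) j) = x.2.2 (P i q j)) ∧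
      y.2.1 * δ ≤ (2 * u i + 2 * u (i + 1)) * ∑ j, x.2.2 (P i q j)
  have h0 : ∃ x, p 0 x := by
    obtain ⟨m, hm⟩ := exists_nat_ge (max 1 (r 1 / δ))
    have hm1 : 1 ≤ m := by exact_mod_cast (le_max_left _ _).trans hm
    refine ⟨(m, 0, fun v => m * v), isDistortion_mul hm1,
      (div_le_iff₀ hδ).1 ((le_max_right _ _).trans hm), fun j => ?_⟩
    exact mul_pos (by exact_mod_cast hm1) ((hP 0).rigidPoint_start.1 j)
  have hs : ∀ i x, p i x → ∃ y, p (i + 1) y ∧ R i x y := by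
    rintro i ⟨m, E, φ⟩ ⟨hφ, hm, hpos⟩
    have hlarge : ∀ᶠ q in atTop, ∀ j, (i : ℝ) < φ (P i q j) := by
      filter_upwards [(hP i).eventually_lt_apply (i + E * δ)] with q hq j
      have h1 := (abs_le.1 (hφ.close (P i q j))).1
      have h2 : (1 : ℝ) ≤ m := by exact_mod_cast hφ.one_le
      have h3 : 0 ≤ P i q j := le_trans (by positivity) (hq j).le
      nlinarith [hq j]
    obtain ⟨q, m₂, E₂, φ₂, hrq, ⟨hQ, hlt, hle⟩, hqs, hφ₂, hm₂, heq, hE₂⟩ :=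
      (hP i).exists_next_distortion (hP (i + 1)) hn hδ hφ hm (hu i) (hu (i + 1)) (hfreq i)
        (hl (i + 1)) (r (i + 2)) ((eventually_ge_atTop (Q i)).and (hlarge.and
          (((hP i).tendsto_sum_comp hφ).eventually_ge_atTop (i : ℝ))))
    refine ⟨(m₂, E₂, φ₂), ⟨hφ₂, hm₂, fun j => ?_⟩, q, hrq, hQ, hqs, hlt, hle, heq, hE₂⟩
    simp only [heq j]
    exact (Nat.cast_nonneg i).trans_lt (hlt j)
  obtain ⟨f, hf⟩ := exists_seq_of_forall_exists_succ h0 hs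
  have hdist := fun i => (hf i).1.1
  have hpos := fun i => (hf i).1.2.2
  choose q hrq hQq hqs hlt hle hstep hE using fun i => (hf i).2
  choose R hR hRφ hRs using fun i => (hP i).exists_distortion hn (hdist i) (hpos i)
  set T : ℕ → ℝ := fun i => ∑ j, (f i).2.2 (P i (r i) j) with hTdef
  have hTs : ∀ i, T (i + 1) = ∑ j, (f i).2.2 (P i (q i) j) := fun i =>
    Finset.sum_congr rfl fun j _ => hstep i j
  have hTmono : StrictMono T := strictMono_nat_of_lt_succ fun i => by
    rw [hTs i]
    exact (hP i).strictMonoOn_sum_comp (hdist i).strictMono self_mem_Ici (hrq i).le (hrq i)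
  have hTlim : Tendsto T atTop atTop := by
    rw [← tendsto_add_atTop_iff_nat 1]
    exact tendsto_atTop_mono (fun i => (hle i).trans_eq (hTs i).symm) tendsto_natCast_atTop_atTop
  have hglue : ∀ i, R i (T (i + 1)) = R (i + 1) (T (i + 1)) := fun i => by
    rw [hRφ (i + 1) _ le_rfl, hTs i, hRφ i _ (hrq i).le]
    exact funext fun j => (hstep i j).symm
  obtain ⟨S, hS, hSR⟩ := exists_isHalfLineRigid_glue hTmono hTlim hR hglue
    (fun i => hRs i (r i) le_rfl ⟨0, hn⟩ (hslope i)) (fun M => by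
      obtain ⟨i, hi⟩ := exists_nat_ge M
      refine ⟨i + 1, fun j => ?_⟩
      rw [hRφ (i + 1) _ le_rfl]
      simp only [hstep i j]
      exact hi.trans_lt (hlt i j))
  refine ⟨q, T, fun i => (f i).1, fun i => (f i).2.1, fun i => (f i).2.2, S, hTmono, hTlim, hS,
    fun i => ⟨hdist i, hrq i, hQq i, rfl, hTs i, by rw [hTs i]; exact hE i, fun s hs => ?_⟩⟩
  have hmono := ((hP i).strictMonoOn_sum_comp (hdist i).strictMono).monotoneOn
  rw [hSR i, hRφ i s hs.1]
  exact ⟨hmono self_mem_Ici hs.1 hs.1, (hmono hs.1 (hrq i).le hs.2).trans_eq (hTs i).symm⟩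

theorem exists_mem_Ico_succ {T : ℕ → ℝ} (hT : Tendsto T atTop atTop) {N : ℕ} {t : ℝ}
    (ht : T N ≤ t) : ∃ i, N ≤ i ∧ t ∈ Ico (T i) (T (i + 1)) := by
  by_contra! hcon
  have hle : ∀ i, N ≤ i → T i ≤ t := fun i hi => by
    induction i, hi using Nat.le_induction with
    | base => exact ht
    | succ i hi ih => exact not_lt.1 fun h => hcon i hi ⟨ih, h⟩
  obtain ⟨i, h1, h2⟩ := ((hT.eventually_gt_atTop t).and (eventually_ge_atTop N)).exists
  exact (hle i h2).not_gt h1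

theorem FSet_eq_setLimsup {t₀ : ℝ} {S : ℝ → RVec n} {F : ℕ → Set (RVec n)}
    (hF : ∀ i, (F i).Nonempty) {T : ℕ → ℝ} (hT0 : t₀ ≤ T 0) (hTmono : Monotone T)
    (hT : Tendsto T atTop atTop) {η : ℕ → ℝ} (hη : Tendsto η atTop (𝓝 0))
    (h1 : ∀ i, ∀ t ∈ Icc (T (i + 1)) (T (i + 2)), ∃ y ∈ F (i + 1), dist (t⁻¹ • S t) y ≤ η i)
    (h2 : ∀ i, ∀ y ∈ F (i + 1), ∃ t, T (i + 1) ≤ t ∧ dist (t⁻¹ • S t) y ≤ η i) :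
    FSet n (Ici t₀) S = setLimsup n F := by
  ext x
  rw [mem_FSet_iff, mem_setLimsup_iff hF]
  constructor
  · intro h ε hε N
    obtain ⟨N', hN'⟩ := eventually_atTop.1 (hη.eventually_lt_const (half_pos hε))
    obtain ⟨t, -, hTt, hdist⟩ := h (ε / 2) (half_pos hε) (T (max N N' + 1))
    obtain ⟨i, hi, hti⟩ := exists_mem_Ico_succ hT hTt
    obtain ⟨j, rfl⟩ : ∃ j, i = j + 1 := ⟨i - 1, by omega⟩
    obtain ⟨y, hy, hty⟩ := h1 j t (Ico_subset_Icc_self hti)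
    refine ⟨j + 1, by omega, y, hy, ?_⟩
    have := hN' j (by omega)
    rw [dist_comm] at hty
    linarith [dist_triangle y (t⁻¹ • S t) x]
  · intro h ε hε M
    obtain ⟨N, hN⟩ := eventually_atTop.1
      ((hη.eventually_lt_const (half_pos hε)).and (hT.eventually_ge_atTop M))
    obtain ⟨i, hi, y, hy, hyx⟩ := h (ε / 2) (half_pos hε) (N + 1)
    obtain ⟨j, rfl⟩ : ∃ j, i = j + 1 := ⟨i - 1, by omega⟩
    obtain ⟨t, hTt, hty⟩ := h2 j y hy
    refine ⟨t, (hT0.trans (hTmono (Nat.zero_le _))).trans hTt,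
      ((hN (j + 1) (by omega)).2).trans hTt, ?_⟩
    linarith [(hN j (by omega)).1, dist_triangle (t⁻¹ • S t) y x]

end HalfLine

/-- **Theorem (composite systems).** Given a sequence of proper rigid `n`-systems
`R⁽ⁱ⁾` of the same mesh `δ` admitting a convergent sequence of points
`x⁽ⁱ⁾ ∈ F(R⁽ⁱ⁾, e₁)`, there is a proper rigid `n`-system `R` of mesh `δ` with
`F(R) = limsup_i F(R⁽ⁱ⁾)`. -/
theorem composite_system (n : ℕ) (hn : 2 ≤ n) (δ : ℝ) (hδ : 0 < δ)
    (I : ℕ → Set ℝ) (R : ℕ → ℝ → RVec n)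
    (hrig : ∀ i, IsRigid n δ (I i) (R i))
    (hprop : ∀ i, IsProperSys n (I i) (R i))
    (x : ℕ → RVec n) (hx : ∀ i, x i ∈ FSetE1 n (I i) (R i))
    (l : RVec n) (hconv : Filter.Tendsto x Filter.atTop (nhds l)) :
    ∃ (J : Set ℝ) (S : ℝ → RVec n),
      IsRigid n δ J S ∧ IsProperSys n J S ∧
      FSet n J S = setLimsup n (fun i => FSet n (I i) (R i)) := by
  have hn0 : 0 < n := by omega
  choose a ha hR using fun i => (hrig i).exists_isHalfLineRigid hn0 (hprop i)
  obtain rfl : I = fun i => Ici (a i) := funext ha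
  have hη : ∀ i : ℕ, 0 < 1 / ((i : ℝ) + 1) := fun i => by positivity
  set u : ℕ → ℝ := fun i => dist (x i) l + 1 / (i + 1) with hu_def
  have hu : ∀ i, 0 < u i := fun i => add_pos_of_nonneg_of_pos dist_nonneg (hη i)
  have hulim : Tendsto u atTop (𝓝 0) := by
    simpa [hu_def] using
      (tendsto_iff_dist_tendsto_zero.1 hconv).add tendsto_one_div_add_atTop_nhds_zero_nat
  have hfreq : ∀ i, ∃ᶠ q in atTop,
      IsRigidPoint δ (R i q) ∧ HasRightSlope (R i) q 0 ∧ dist (q⁻¹ • R i q) l < u i := fun i =>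
    ((hR i).frequently_rigidPoint hn0 hδ (hx i) (hη i)).mono fun q hq =>
      ⟨hq.1, hq.2.1, by linarith [dist_triangle (q⁻¹ • R i q) (x i) l, hq.2.2]⟩
  choose M hM using fun i => (hR i).exists_forall_dist_FSet_lt (hη i)
  choose r hr har hMr using fun i => ((hfreq i).and_eventually
    ((eventually_ge_atTop (a i)).and (eventually_ge_atTop (M i)))).exists
  have hP := fun i => (hR i).restrict_of_le (har i) (hr i).1
  choose Q hQ using fun i => (hP i).exists_forall_FSet_exists_dist_lt (hη i)
  obtain ⟨q, T, m, E, φ, S, hTmono, hTlim, hS, hcomp⟩ := exists_composite hn0 hδ hP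
    (fun i => (hr i).2.1) hu (fun i => (hr i).2.2) hfreq Q
  refine ⟨Ici (T 0), S, hS.isRigid hn0, hS.isProperSys hn0, ?_⟩
  have hdist : ∀ i, ∀ s ∈ Icc (r (i + 1)) (q (i + 1)), ∀ t, ∑ j, φ (i + 1) (R (i + 1) s j) = t →
      T (i + 1) ≤ t ∧
      dist (t⁻¹ • S t) (s⁻¹ • R (i + 1) s) ≤ (n + 1) * (2 * u i + 2 * u (i + 1)) := by
    rintro i s hs t rfl
    obtain ⟨hφ, hrq, -, hT, -, -, hSs⟩ := hcomp (i + 1)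
    have hE := (hcomp i).2.2.2.2.2.1
    have hTt : T (i + 1) ≤ ∑ j, φ (i + 1) (R (i + 1) s j) := by
      rw [hT]
      exact ((hP (i + 1)).strictMonoOn_sum_comp hφ.strictMono).monotoneOn self_mem_Ici hs.1 hs.1
    have hTpos : 0 < T (i + 1) := hS.pos.trans_le (hTmono.monotone (Nat.zero_le _))
    refine ⟨hTt, ?_⟩
    rw [hSs s hs]
    refine ((hP (i + 1)).dist_inv_smul_le (m := m (i + 1)) (e := E (i + 1) * δ) hs.1
      (hTpos.trans_le hTt) (by positivity) (fun j => hφ.close _)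
      ((hP (i + 1)).abs_sum_comp_sub_le hφ hs.1)).trans ?_
    rw [div_le_iff₀ (hTpos.trans_le hTt)]
    have he : 0 ≤ 2 * u i + 2 * u (i + 1) := by linarith [hu i, hu (i + 1)]
    have hE' := hE.trans (mul_le_mul_of_nonneg_left hTt he)
    have := mul_le_mul_of_nonneg_left hE' (show (0 : ℝ) ≤ n + 1 by positivity)
    linarith
  refine FSet_eq_setLimsup (η := fun i : ℕ =>
    (n + 1) * (2 * u i + 2 * u (i + 1)) + 1 / (((i + 1 : ℕ) : ℝ) + 1))
    (fun i => ⟨x i, FSetE1_subset_FSet _ _ (hx i)⟩) le_rfl hTmono.monotone hTlim ?_ ?_ ?_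
  · have hulim' := (tendsto_add_atTop_iff_nat 1).2 hulim
    have hηlim := (tendsto_add_atTop_iff_nat 1).2
      (tendsto_one_div_add_atTop_nhds_zero_nat (𝕜 := ℝ))
    simpa using (((hulim.const_mul 2).add (hulim'.const_mul 2)).const_mul ((n : ℝ) + 1)).add hηlim
  · intro i t ht
    obtain ⟨hφ, hrq, -, hT, hT', -, -⟩ := hcomp (i + 1)
    rw [hT, hT'] at ht
    obtain ⟨s, hs, hst⟩ := intermediate_value_Icc hrq.le
      (((hP (i + 1)).continuousOn_sum_comp hφ.continuous).mono Icc_subset_Ici_self) ht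
    obtain ⟨y, hy, hsy⟩ := hM (i + 1) s ((hMr (i + 1)).trans hs.1)
    refine ⟨y, hy, (dist_triangle _ (s⁻¹ • R (i + 1) s) _).trans ?_⟩
    exact add_le_add (hdist i s hs t hst).2 hsy.le
  · intro i y hy
    rw [← FSet_Ici_eq (har (i + 1))] at hy
    obtain ⟨s, hs, hsy⟩ := hQ (i + 1) y hy
    obtain ⟨hTt, hts⟩ := hdist i s ⟨hs.1, hs.2.trans (hcomp (i + 1)).2.2.1⟩ _ rfl
    exact ⟨_, hTt, (dist_triangle _ (s⁻¹ • R (i + 1) s) _).trans (add_le_add hts hsy.le)⟩
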